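/- For any Lagrangian subspaces L1, L2, L3 of a real symplectic vector space (E, ω) of dimension 2n, the integer s(L1,L2,L3) + dim(L1∩L2) + dim(L2∩L3) + dim(L3∩L1) + n is even. -/

import Mathlib

open LinearMap (BilinForm)

variable {E : Type*} [AddCommGroup E] [Module ℝ E]

/-- A subspace is Lagrangian iff it equals its symplectic orthogonal. -/
def IsLagrangian (ω : BilinForm ℝ E) (L : Submodule ℝ E) : Prop :=
  LinearMap.BilinForm.orthogonal ω L = L

/-- Maximal dimension of a subspace on which the function `Q` is positive away from `0`. -/
noncomputable def posIndex {V : Type*} [AddCommGroup V] [Module ℝ V] (Q : V → ℝ) : ℕ :=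
  sSup {d : ℕ | ∃ W : Submodule ℝ V, Module.finrank ℝ W = d ∧ ∀ x ∈ W, x ≠ 0 → 0 < Q x}

/-- The quadratic form `Q(L1,L2,L3)` of a triplet of subspaces,
`Q(x1,x2,x3) = ω(x1,x2) + ω(x2,x3) + ω(x3,x1)`. -/
def tripleQ (ω : BilinForm ℝ E) (L1 L2 L3 : Submodule ℝ E) (v : L1 × L2 × L3) : ℝ :=
  ω v.1 v.2.1 + ω v.2.1 v.2.2 + ω v.2.2 v.1

/-- The signature `s(L1,L2,L3)` of a triplet of subspaces:  the signature (number of positive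
squares minus number of negative squares in a diagonalization) of `Q(L1,L2,L3)`, computed as the
maximal dimension of a subspace on which the form is positive definite minus the maximal dimension
of a subspace on which it is negative definite. -/
noncomputable def tripleSig (ω : BilinForm ℝ E) (L1 L2 L3 : Submodule ℝ E) : ℤ :=
  (posIndex (tripleQ ω L1 L2 L3) : ℤ) - (posIndex (fun v => - tripleQ ω L1 L2 L3 v) : ℤ)

/-- `posIndex` of a quadratic form is Mathlib's positive index of inertia. -/
lemma posIndex_eq_sigPos {V : Type*} [AddCommGroup V] [Module ℝ V] [FiniteDimensional ℝ V]
    (Q : QuadraticForm ℝ V) : posIndex Q = sigPos Q := by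
  refine Eq.trans ?_ (sigPos_isGreatest Q).csSup_eq
  simp [posIndex, QuadraticMap.PosDef]

/-- A Lagrangian subspace of a symplectic space of dimension `2 * n` has dimension `n`. -/
lemma IsLagrangian.finrank_eq [FiniteDimensional ℝ E] {ω : BilinForm ℝ E}
    (hnd : LinearMap.BilinForm.Nondegenerate ω) {n : ℕ} (hdim : Module.finrank ℝ E = 2 * n)
    {L : Submodule ℝ E} (h : IsLagrangian ω L) : Module.finrank ℝ L = n := by
  have h_orth := LinearMap.BilinForm.finrank_orthogonal hnd L
  have h_le := L.finrank_le
  rw [h] at h_orth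
  lia

/-- The form `tripleQ` as a quadratic form. -/
def tripleForm (ω : BilinForm ℝ E) (L1 L2 L3 : Submodule ℝ E) : QuadraticForm ℝ (L1 × L2 × L3) :=
  let p1 := L1.subtype ∘ₗ LinearMap.fst ℝ L1 (L2 × L3)
  let p2 := L2.subtype ∘ₗ LinearMap.fst ℝ L2 L3 ∘ₗ LinearMap.snd ℝ L1 (L2 × L3)
  let p3 := L3.subtype ∘ₗ LinearMap.snd ℝ L2 L3 ∘ₗ LinearMap.snd ℝ L1 (L2 × L3)
  LinearMap.BilinMap.toQuadraticMap
    (ω.compl₁₂ p1 p2 + ω.compl₁₂ p2 p3 + ω.compl₁₂ p3 p1)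

lemma tripleForm_apply (ω : BilinForm ℝ E) (L1 L2 L3 : Submodule ℝ E) (v : L1 × L2 × L3) :
    tripleForm ω L1 L2 L3 v = ω v.1 v.2.1 + ω v.2.1 v.2.2 + ω v.2.2 v.1 := rfl

lemma mem_radical_tripleForm_iff {ω : BilinForm ℝ E} (halt : LinearMap.IsAlt ω)
    {L1 L2 L3 : Submodule ℝ E} (h1 : IsLagrangian ω L1) (h2 : IsLagrangian ω L2)
    (h3 : IsLagrangian ω L3) (x : L1 × L2 × L3) :
    x ∈ (tripleForm ω L1 L2 L3).radical ↔
      (x.2.1 - x.2.2 : E) ∈ L1 ∧ (x.2.2 - x.1 : E) ∈ L2 ∧ (x.1 - x.2.1 : E) ∈ L3 := by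
  obtain ⟨x1, x2, x3⟩ := x
  have hswap (a b : E) : ω a b = -ω b a := (halt.neg b a).symm
  have hmem {L : Submodule ℝ E} (h : IsLagrangian ω L) (z : E) : z ∈ L ↔ ∀ y ∈ L, ω y z = 0 := by
    conv_lhs => rw [← h]
    rfl
  have hpolar (y1 : L1) (y2 : L2) (y3 : L3) :
      QuadraticMap.polar (tripleForm ω L1 L2 L3) (x1, x2, x3) (y1, y2, y3) =
        ω y1 (x2 - x3 : E) + ω y2 (x3 - x1 : E) + ω y3 (x1 - x2 : E) := by
    simp only [QuadraticMap.polar, tripleForm_apply, Prod.mk_add_mk, Submodule.coe_add, map_add,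
      map_sub, LinearMap.add_apply]
    rw [hswap x1 y2, hswap x2 y3, hswap x3 y1]
    ring
  rw [QuadraticMap.radical_eq_ker_polarBilin, LinearMap.mem_ker, LinearMap.ext_iff]
  simp only [Prod.forall, QuadraticMap.polarBilin_apply_apply, LinearMap.zero_apply, hpolar,
    hmem h1 (_ - _), hmem h2 (_ - _), hmem h3 (_ - _)]
  constructor
  · intro h
    exact ⟨fun y hy ↦ by simpa using h ⟨y, hy⟩ 0 0, fun y hy ↦ by simpa using h 0 ⟨y, hy⟩ 0,
      fun y hy ↦ by simpa using h 0 0 ⟨y, hy⟩⟩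
  · rintro ⟨k1, k2, k3⟩ y1 y2 y3
    rw [k1 y1 y1.2, k2 y2 y2.2, k3 y3 y3.2]
    simp

/-- The radical of `tripleForm` is parametrized by the pairwise intersections, through
`(c, a, b) ↦ (b + c, c + a, a + b)`. -/
lemma finrank_radical_tripleForm [FiniteDimensional ℝ E] {ω : BilinForm ℝ E}
    (halt : LinearMap.IsAlt ω) {L1 L2 L3 : Submodule ℝ E} (h1 : IsLagrangian ω L1)
    (h2 : IsLagrangian ω L2) (h3 : IsLagrangian ω L3) :
    Module.finrank ℝ (tripleForm ω L1 L2 L3).radical =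
      Module.finrank ℝ ↥(L1 ⊓ L2) + Module.finrank ℝ ↥(L2 ⊓ L3) + Module.finrank ℝ ↥(L3 ⊓ L1) := by
  let f : (↥(L1 ⊓ L2) × ↥(L2 ⊓ L3) × ↥(L3 ⊓ L1)) →ₗ[ℝ] L1 × L2 × L3 :=
    { toFun := fun v ↦ (⟨v.2.2 + v.1, L1.add_mem v.2.2.2.2 v.1.2.1⟩,
        ⟨v.1 + v.2.1, L2.add_mem v.1.2.2 v.2.1.2.1⟩,
        ⟨v.2.1 + v.2.2, L3.add_mem v.2.1.2.2 v.2.2.2.1⟩)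
      map_add' := fun v w ↦ by
        ext <;> simp only [Prod.fst_add, Prod.snd_add, Submodule.coe_add] <;> abel
      map_smul' := fun r v ↦ by ext <;> simp }
  have hinj : Function.Injective f := by
    rw [← LinearMap.ker_eq_bot, LinearMap.ker_eq_bot']
    rintro ⟨c, a, b⟩ h
    simp only [f, LinearMap.coe_mk, AddHom.coe_mk, Prod.ext_iff, Subtype.ext_iff, Prod.fst_zero,
      Prod.snd_zero, Submodule.coe_zero] at h ⊢
    obtain ⟨k1, k2, k3⟩ := h
    refine ⟨?_, ?_, ?_⟩
    · linear_combination (norm := module) (1 / 2 : ℝ) • (k1 + k2 - k3)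
    · linear_combination (norm := module) (1 / 2 : ℝ) • (k2 + k3 - k1)
    · linear_combination (norm := module) (1 / 2 : ℝ) • (k3 + k1 - k2)
  have hrange : LinearMap.range f = (tripleForm ω L1 L2 L3).radical := by
    ext ⟨x1, x2, x3⟩
    rw [mem_radical_tripleForm_iff halt h1 h2 h3]
    constructor
    · rintro ⟨⟨c, a, b⟩, h⟩
      simp only [f, LinearMap.coe_mk, AddHom.coe_mk, Prod.ext_iff, Subtype.ext_iff] at h ⊢
      obtain ⟨k1, k2, k3⟩ := h
      rw [← k1, ← k2, ← k3]
      refine ⟨?_, ?_, ?_⟩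
      · convert L1.sub_mem c.2.1 b.2.2 using 1; abel
      · convert L2.sub_mem a.2.1 c.2.2 using 1; abel
      · convert L3.sub_mem b.2.1 a.2.2 using 1; abel
    · rintro ⟨k1, k2, k3⟩
      dsimp only at k1 k2 k3
      refine ⟨(
        ⟨(1 / 2 : ℝ) • (x1 + x2 - x3 : E), Submodule.smul_mem _ _ (Submodule.mem_inf.2 ⟨?_, ?_⟩)⟩,
        ⟨(1 / 2 : ℝ) • (x2 + x3 - x1 : E), Submodule.smul_mem _ _ (Submodule.mem_inf.2 ⟨?_, ?_⟩)⟩,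
        ⟨(1 / 2 : ℝ) • (x3 + x1 - x2 : E), Submodule.smul_mem _ _ (Submodule.mem_inf.2 ⟨?_, ?_⟩)⟩), ?_⟩
      · convert L1.add_mem x1.2 k1 using 1; abel
      · convert L2.sub_mem x2.2 k2 using 1; abel
      · convert L2.add_mem x2.2 k2 using 1; abel
      · convert L3.sub_mem x3.2 k3 using 1; abel
      · convert L3.add_mem x3.2 k3 using 1; abel
      · convert L1.sub_mem x1.2 k1 using 1; abel
      · simp only [f, LinearMap.coe_mk, AddHom.coe_mk, Prod.ext_iff, Subtype.ext_iff]
        refine ⟨?_, ?_, ?_⟩ <;> module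
  rw [← hrange, LinearMap.finrank_range_of_inj hinj, Module.finrank_prod, Module.finrank_prod,
    add_assoc]

/-- for Lagrangian subspaces `L1, L2, L3` of a `2n`-dimensional real symplectic
vector space, `s(L1,L2,L3) + dim(L1∩L2) + dim(L2∩L3) + dim(L3∩L1) + n` is even. -/
theorem signature_parity [FiniteDimensional ℝ E]
    (ω : BilinForm ℝ E) (halt : LinearMap.IsAlt ω)
    (hnd : LinearMap.BilinForm.Nondegenerate ω)
    (n : ℕ) (hdim : Module.finrank ℝ E = 2 * n)
    (L1 L2 L3 : Submodule ℝ E)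
    (h1 : IsLagrangian ω L1) (h2 : IsLagrangian ω L2) (h3 : IsLagrangian ω L3) :
    Even (tripleSig ω L1 L2 L3 + (Module.finrank ℝ ↥(L1 ⊓ L2) : ℤ)
      + (Module.finrank ℝ ↥(L2 ⊓ L3) : ℤ) + (Module.finrank ℝ ↥(L3 ⊓ L1) : ℤ) + (n : ℤ)) := by
  have hpos : posIndex (tripleQ ω L1 L2 L3) = sigPos (tripleForm ω L1 L2 L3) :=
    posIndex_eq_sigPos (tripleForm ω L1 L2 L3)
  have hneg : posIndex (fun v ↦ -tripleQ ω L1 L2 L3 v) = sigNeg (tripleForm ω L1 L2 L3) :=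
    posIndex_eq_sigPos (-tripleForm ω L1 L2 L3)
  have hsum := QuadraticForm.sigPos_add_sigNeg_add_radical (Q := tripleForm ω L1 L2 L3)
  rw [finrank_radical_tripleForm halt h1 h2 h3, Module.finrank_prod, Module.finrank_prod,
    h1.finrank_eq hnd hdim, h2.finrank_eq hnd hdim, h3.finrank_eq hnd hdim] at hsum
  rw [tripleSig, hpos, hneg]
  grind
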